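/- The group G_A is isomorphic to the lamplighter group ℤ₃ ≀ ℤ, i.e., to the semidirect product (⨁_{i∈ℤ} ℤ/3ℤ) ⋊ ℤ, where ℤ acts on the direct sum by shifting the coordinates. -/

import Mathlib

/-!
We formalize the automaton `A` of the paper: alphabet `X = {1,2,3}` is encoded as
`Fin 3` (letter `i+1` ↦ `i`), states `a, b, c` are encoded as `0, 1, 2 : Fin 3`.
Each state induces a permutation of the space `ℕ → Fin 3` of infinite sequences.

Note on conventions: in the paper, products of tree automorphisms compose
left-to-right (in a word `s₁s₂⋯sₙ`, the letter `s₁` acts first); in Mathlib,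
`(f * g) w = f (g w)`, i.e. the right factor acts first.  Hence a paper word
`uv` is rendered as the Lean product `v * u`; e.g. the paper's `α = ab⁻¹`
(apply `a`, then `b⁻¹`) is `b⁻¹ * a` below.
-/

namespace Lamplighter

section Generic

variable {S X : Type*}

/-- The state of the automaton after reading the first `n` letters of `w`, starting at `s`. -/
def run (nxt : S → X → S) (s : S) (w : ℕ → X) : ℕ → S
  | 0 => s
  | n + 1 => nxt (run nxt s w n) (w n)

/-- The output sequence of the automaton started in state `s` reading `w`. -/
def fwd (nxt : S → X → S) (out : S → Equiv.Perm X) (s : S) (w : ℕ → X) : ℕ → X :=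
  fun n => out (run nxt s w n) (w n)

/-- Transition function of the inverse automaton. -/
def invNxt (nxt : S → X → S) (out : S → Equiv.Perm X) (s : S) (y : X) : S :=
  nxt s ((out s).symm y)

/-- The action of the inverse automaton, started at state `s`. -/
def bwd (nxt : S → X → S) (out : S → Equiv.Perm X) (s : S) (y : ℕ → X) : ℕ → X :=
  fun n => (out (run (invNxt nxt out) s y n)).symm (y n)

theorem run_inv_fwd (nxt : S → X → S) (out : S → Equiv.Perm X) (s : S) (w : ℕ → X) :
    ∀ n, run (invNxt nxt out) s (fwd nxt out s w) n = run nxt s w n := by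
  intro n
  induction n with
  | zero => rfl
  | succ n ih => simp [run, ih, invNxt, fwd]

theorem run_bwd (nxt : S → X → S) (out : S → Equiv.Perm X) (s : S) (y : ℕ → X) :
    ∀ n, run nxt s (bwd nxt out s y) n = run (invNxt nxt out) s y n := by
  intro n
  induction n with
  | zero => rfl
  | succ n ih => simp [run, ih, bwd, invNxt]

/-- The permutation of the space of infinite sequences induced by state `s`
of an invertible automaton. -/
def statePerm (nxt : S → X → S) (out : S → Equiv.Perm X) (s : S) : Equiv.Perm (ℕ → X) where
  toFun := fwd nxt out s
  invFun := bwd nxt out s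
  left_inv := fun w => funext fun n => by simp [bwd, run_inv_fwd, fwd]
  right_inv := fun y => funext fun n => by simp [fwd, run_bwd, bwd]

end Generic

/-- The alphabet `X = {1,2,3}`, encoded as `Fin 3`. -/
abbrev X3 := Fin 3

/-- Transition function of the automaton `A` (states `a = 0`, `b = 1`, `c = 2`):
from `a`: `1 ↦ a, 2 ↦ b, 3 ↦ c`; from `b`: `1 ↦ c, 2 ↦ a, 3 ↦ b`;
from `c`: `1 ↦ b, 2 ↦ c, 3 ↦ a`. -/
def nxtA : Fin 3 → X3 → Fin 3 := ![![0, 1, 2], ![2, 0, 1], ![1, 2, 0]]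

/-- Output permutations of the automaton `A`: state `a` acts on letters as the
transposition `(2 3)`, state `b` as `(1 3)`, state `c` as `(1 2)`. -/
def outA : Fin 3 → Equiv.Perm X3 := ![Equiv.swap 1 2, Equiv.swap 0 2, Equiv.swap 0 1]

/-- The permutation of `X^ℕ` given by state `a`. -/
def a : Equiv.Perm (ℕ → X3) := statePerm nxtA outA 0

/-- The permutation of `X^ℕ` given by state `b`. -/
def b : Equiv.Perm (ℕ → X3) := statePerm nxtA outA 1

/-- The permutation of `X^ℕ` given by state `c`. -/
def c : Equiv.Perm (ℕ → X3) := statePerm nxtA outA 2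

/-- The group `G_A` generated by the automaton `A`. -/
def GA : Subgroup (Equiv.Perm (ℕ → X3)) := Subgroup.closure {a, b, c}

/-- The element `α = ab⁻¹` of the paper (first apply `a`, then `b⁻¹`). -/
def α : Equiv.Perm (ℕ → X3) := b⁻¹ * a

/-- The set `W` of permutations acting coordinatewise by a sequence of even
permutations of the alphabet. -/
def W : Set (Equiv.Perm (ℕ → X3)) :=
  {g | ∃ π : ℕ → Equiv.Perm X3, (∀ n, Equiv.Perm.sign (π n) = 1) ∧
    ∀ (w : ℕ → X3) (n : ℕ), g w n = π n (w n)}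

/-- The subgroup `N` generated by the conjugates `a⁻ⁿ α aⁿ`, `n ∈ ℤ`
(in Lean's composition order: `aⁿ * α * a⁻ⁿ`). -/
def N : Subgroup (Equiv.Perm (ℕ → X3)) :=
  Subgroup.closure {g | ∃ n : ℤ, g = a ^ n * α * a ^ (-n)}

/-- The integer powers of a transcendental unit are linearly independent. -/
theorem linearIndependent_zpow_of_transcendental {K R : Type*} [CommRing K] [CommRing R]
    [Algebra K R] (x : Rˣ) (hx : Transcendental K (x : R)) :
    LinearIndependent K (fun i : ℤ => ((x ^ i : Rˣ) : R)) := by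
  rw [linearIndependent_iff']
  intro s g hg j hj
  obtain ⟨N, hN⟩ : ∃ N : ℤ, ∀ i ∈ s, 0 ≤ i + N := by
    obtain ⟨m, hm⟩ := s.bddBelow
    exact ⟨-m, fun i hi => by linarith [hm hi]⟩
  let p : Polynomial K := ∑ i ∈ s, Polynomial.monomial (i + N).toNat (g i)
  have hp : Polynomial.aeval (x : R) p = 0 := by
    have h : Polynomial.aeval (x : R) p =
        (∑ i ∈ s, g i • ((x ^ i : Rˣ) : R)) * ((x ^ N : Rˣ) : R) := by
      rw [map_sum, Finset.sum_mul]
      refine Finset.sum_congr rfl fun i hi => ?_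
      rw [Polynomial.aeval_monomial, smul_mul_assoc, ← Units.val_mul, ← zpow_add,
        ← Units.val_pow_eq_pow_val, ← zpow_natCast, Int.toNat_of_nonneg (hN i hi),
        Algebra.smul_def]
    rw [h, hg, zero_mul]
  have hp0 : p = 0 := by
    by_contra h
    exact hx ⟨p, h, hp⟩
  have hc := congrArg (fun q => Polynomial.coeff q (j + N).toNat) hp0
  simp only [p, Polynomial.finsetSum_coeff, Polynomial.coeff_monomial, Polynomial.coeff_zero] at hc
  rw [Finset.sum_eq_single j] at hc
  · simpa using hc
  · intro i hi hij
    have h1 := hN i hi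
    have h2 := hN j hj
    exact if_neg (by omega)
  · exact fun h => absurd hj h

open PowerSeries

/-- The identification of power series over `ZMod 3` with infinite sequences of letters. -/
noncomputable def seqEquiv : PowerSeries (ZMod 3) ≃ (ℕ → X3) where
  toFun f n := (coeff n f : ZMod 3)
  invFun w := PowerSeries.mk (R := ZMod 3) w
  left_inv f := by ext n; exact coeff_mk n _
  right_inv w := funext fun n => coeff_mk (R := ZMod 3) n (fun k => (w k : ZMod 3))

theorem exists_one_add_X_mul_eq_one : ∃ u : PowerSeries (ZMod 3), (1 + X) * u = 1 :=
  (isUnit_iff_constantCoeff.2 (by simp)).exists_right_inv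

/-- The power series `1 / (1 + t)`. -/
noncomputable def geom : PowerSeries (ZMod 3) := exists_one_add_X_mul_eq_one.choose

theorem one_add_X_mul_geom : (1 + X) * geom = 1 := exists_one_add_X_mul_eq_one.choose_spec

theorem constantCoeff_geom : constantCoeff geom = 1 := by
  simpa using congrArg constantCoeff one_add_X_mul_geom

theorem isUnit_one_add_geom : IsUnit (1 + geom) :=
  isUnit_iff_constantCoeff.2 (by
    rw [map_add, map_one, constantCoeff_geom]
    exact IsUnit.of_mul_eq_one 2 (by decide))

/-- The multiplier `1 + 1 / (1 + t) = -(1 - t) / (1 + t)` of the affine maps given by the states. -/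
noncomputable def ratio : (PowerSeries (ZMod 3))ˣ := isUnit_one_add_geom.unit

theorem val_ratio : (ratio : PowerSeries (ZMod 3)) = 1 + geom := rfl

theorem transcendental_X : Transcendental (ZMod 3) (X : PowerSeries (ZMod 3)) := by
  rintro ⟨p, hp, h⟩
  apply hp
  apply Polynomial.coe_injective (ZMod 3)
  rw [Polynomial.coe_zero, ← h]
  have : (Polynomial.coeToPowerSeries.algHom (ZMod 3) : Polynomial (ZMod 3) →ₐ[ZMod 3] _) =
      Polynomial.aeval (X : PowerSeries (ZMod 3)) := by
    ext1
    simp [Polynomial.coeToPowerSeries.algHom_apply]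
  rw [← this, Polynomial.coeToPowerSeries.algHom_apply]
  simp

theorem transcendental_ratio : Transcendental (ZMod 3) (ratio : PowerSeries (ZMod 3)) := by
  intro h
  apply transcendental_X
  have hu : IsAlgebraic (ZMod 3) geom := by
    have := h.sub isAlgebraic_one
    rwa [val_ratio, add_sub_cancel_left] at this
  let _ : Invertible geom := ⟨1 + X, one_add_X_mul_geom, by rw [mul_comm, one_add_X_mul_geom]⟩
  have hv : IsAlgebraic (ZMod 3) (1 + X : PowerSeries (ZMod 3)) := hu.invOf
  simpa using hv.sub isAlgebraic_one

theorem nxtA_eq (s x : ZMod 3) : nxtA s x = x - s :=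
  (by decide : ∀ s x : Fin 3, nxtA s x = x - s) s x

theorem outA_eq (s x : ZMod 3) : outA s x = -x - s :=
  (by decide : ∀ s x : Fin 3, outA s x = -x - s) s x

/-- State `s` acts on power series as an affine map. -/
theorem statePerm_seqEquiv (s : ZMod 3) (f : PowerSeries (ZMod 3)) :
    statePerm nxtA outA s (seqEquiv f) = seqEquiv (-s • geom + ratio * f) := by
  rw [← Equiv.symm_apply_eq]
  let S : PowerSeries (ZMod 3) := PowerSeries.mk (R := ZMod 3) (run nxtA s (seqEquiv f))
  have hS : S = s • (1 : PowerSeries (ZMod 3)) + X * (f - S) := by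
    ext n
    cases n with
    | zero => simp [S, run]
    | succ n =>
      have h : coeff (n + 1) S = coeff n f - coeff n S := by
        simp only [S, coeff_mk]
        exact nxtA_eq (run nxtA s (seqEquiv f) n) (coeff n f)
      rw [h]
      simp [coeff_succ_X_mul, coeff_one]
  have hY : seqEquiv.symm (statePerm nxtA outA s (seqEquiv f)) = -f - S := by
    ext n
    rw [map_sub, map_neg, coeff_mk]
    exact (coeff_mk (R := ZMod 3) n (statePerm nxtA outA s (seqEquiv f))).trans
      (outA_eq (run nxtA s (seqEquiv f) n) (coeff n f))
  have h3 : (3 : PowerSeries (ZMod 3)) = 0 := by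
    have : (3 : ZMod 3) = 0 := by decide
    rw [← map_ofNat (C (R := ZMod 3)) 3, this, map_zero]
  rw [hY, val_ratio, Algebra.smul_def, map_neg]
  rw [Algebra.smul_def] at hS
  linear_combination (S - f) * one_add_X_mul_geom - geom * hS - f * h3

/-- The homomorphism sending a power series to the corresponding translation of sequences. -/
noncomputable def translation :
    Multiplicative (PowerSeries (ZMod 3)) →* Equiv.Perm (ℕ → X3) where
  toFun g := seqEquiv.permCongr (Equiv.addLeft g.toAdd)
  map_one' := by ext; simp
  map_mul' g h := by ext; simp

theorem translation_seqEquiv (g f : PowerSeries (ZMod 3)) :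
    translation (.ofAdd g) (seqEquiv f) = seqEquiv (g + f) := by
  simp [translation]

theorem a_seqEquiv (f : PowerSeries (ZMod 3)) : a (seqEquiv f) = seqEquiv (ratio * f) := by
  have h := statePerm_seqEquiv 0 f
  rw [neg_zero, zero_smul, zero_add] at h
  exact h

theorem a_zpow_seqEquiv (n : ℤ) (f : PowerSeries (ZMod 3)) :
    (a ^ n) (seqEquiv f) = seqEquiv ((ratio ^ n : (PowerSeries (ZMod 3))ˣ) * f) := by
  have h (n : ℤ) (f : PowerSeries (ZMod 3)) : (a ^ (n + 1)) (seqEquiv f) =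
      (a ^ n) (seqEquiv (ratio * f)) := by
    rw [zpow_add_one, Equiv.Perm.mul_apply, a_seqEquiv]
  induction n generalizing f with
  | zero => simp
  | succ n ih => rw [h, ih, zpow_add_one, Units.val_mul, mul_assoc]
  | pred n ih =>
    have := h (-n - 1) ((ratio⁻¹ : (PowerSeries (ZMod 3))ˣ) * f)
    rw [sub_add_cancel, ih, Units.mul_inv_cancel_left] at this
    rw [← this, zpow_sub_one, Units.val_mul, mul_assoc]

theorem statePerm_eq (s : ZMod 3) :
    statePerm nxtA outA s = translation (.ofAdd (-s • geom)) * a := by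
  refine Equiv.ext (seqEquiv.forall_congr_right.1 fun f => ?_)
  rw [statePerm_seqEquiv, Equiv.Perm.mul_apply, a_seqEquiv, translation_seqEquiv]

theorem a_zpow_mul_translation (n : ℤ) (g : PowerSeries (ZMod 3)) :
    a ^ n * translation (.ofAdd g) =
      translation (.ofAdd ((ratio ^ n : (PowerSeries (ZMod 3))ˣ) * g)) * a ^ n := by
  refine Equiv.ext (seqEquiv.forall_congr_right.1 fun f => ?_)
  simp only [Equiv.Perm.mul_apply, a_zpow_seqEquiv, translation_seqEquiv, mul_add]

/-- The value of a Laurent polynomial at `ratio`, multiplied by `geom`. -/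
noncomputable def lampSeries : (ℤ →₀ ZMod 3) →ₗ[ZMod 3] PowerSeries (ZMod 3) :=
  Finsupp.linearCombination (ZMod 3) fun i : ℤ => ((ratio ^ i : (PowerSeries (ZMod 3))ˣ) : _) * geom

theorem lampSeries_single (i : ℤ) (v : ZMod 3) : lampSeries (Finsupp.single i v) =
    v • (((ratio ^ i : (PowerSeries (ZMod 3))ˣ) : PowerSeries (ZMod 3)) * geom) :=
  Finsupp.linearCombination_single _ _ _

theorem lampSeries_injective : Function.Injective lampSeries := by
  have h := linearIndependent_zpow_of_transcendental ratio transcendental_ratio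
  have hg : Function.Injective (LinearMap.mulRight (ZMod 3) geom) := fun x y hxy => by
    have := congrArg (· * (1 + X)) hxy
    simpa [mul_assoc, mul_comm geom, one_add_X_mul_geom] using this
  have := h.map' _ (LinearMap.ker_eq_bot.2 hg)
  rw [LinearIndependent] at this
  exact this

theorem lampSeries_shift (n : ℤ) (l : ℤ →₀ ZMod 3) :
    lampSeries (Finsupp.domCongr (Equiv.addRight n) l) =
      (ratio ^ n : (PowerSeries (ZMod 3))ˣ) * lampSeries l := by
  induction l using Finsupp.induction_linear with
  | zero => simp
  | add f g hf hg => rw [map_add, map_add, hf, hg, map_add, mul_add]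
  | single i v =>
    have : Finsupp.domCongr (Equiv.addRight n) (Finsupp.single i v) = Finsupp.single (i + n) v :=
      Finsupp.equivMapDomain_single _ _ _
    rw [this, lampSeries_single, lampSeries_single, add_comm, zpow_add, Units.val_mul, mul_assoc,
      mul_smul_comm]

/-- The action of `ℤ` on the direct sum by shifts. -/
noncomputable abbrev shiftHom : Multiplicative ℤ →* MulAut (Multiplicative (ℤ →₀ ZMod 3)) :=
  zpowersHom (MulAut (Multiplicative (ℤ →₀ ZMod 3)))
    (AddEquiv.toMultiplicative (Finsupp.domCongr (Equiv.addRight (1 : ℤ))))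

theorem lampSeries_shiftHom (n : Multiplicative ℤ) (l : Multiplicative (ℤ →₀ ZMod 3)) :
    lampSeries (shiftHom n l).toAdd =
      (ratio ^ n.toAdd : (PowerSeries (ZMod 3))ˣ) * lampSeries l.toAdd := by
  have h1 (l : Multiplicative (ℤ →₀ ZMod 3)) : lampSeries (shiftHom (.ofAdd 1) l).toAdd =
      ratio * lampSeries l.toAdd := by
    simpa [shiftHom] using lampSeries_shift 1 l.toAdd
  have h (n : ℤ) (l : Multiplicative (ℤ →₀ ZMod 3)) :
      lampSeries (shiftHom (.ofAdd (n + 1)) l).toAdd =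
        ratio * lampSeries (shiftHom (.ofAdd n) l).toAdd := by
    rw [add_comm, ofAdd_add, map_mul, MulAut.mul_apply, h1]
  induction n using Multiplicative.rec with | ofAdd n
  rw [toAdd_ofAdd]
  induction n with
  | zero => simp
  | succ n ih => rw [h, ih, zpow_add_one, Units.val_mul, mul_assoc, mul_left_comm]
  | pred n ih =>
    have := h (-n - 1) l
    rw [sub_add_cancel, ih] at this
    rw [zpow_sub_one, Units.val_mul, mul_right_comm, this, mul_right_comm, Units.mul_inv, one_mul]

/-- The homomorphism from the lamplighter group to permutations of sequences. -/
noncomputable def lampHom :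
    Multiplicative (ℤ →₀ ZMod 3) ⋊[shiftHom] Multiplicative ℤ →* Equiv.Perm (ℕ → X3) :=
  SemidirectProduct.lift (translation.comp lampSeries.toAddMonoidHom.toMultiplicative)
    (zpowersHom _ a) (by
      refine fun n => MonoidHom.ext fun l => ?_
      change translation (.ofAdd (lampSeries (shiftHom n l).toAdd)) =
        a ^ n.toAdd * translation (.ofAdd (lampSeries l.toAdd)) * (a ^ n.toAdd)⁻¹
      rw [_root_.eq_mul_inv_iff_mul_eq, a_zpow_mul_translation, lampSeries_shiftHom])

theorem lampHom_mk (l : Multiplicative (ℤ →₀ ZMod 3)) (n : Multiplicative ℤ) :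
    lampHom ⟨l, n⟩ = translation (.ofAdd (lampSeries l.toAdd)) * a ^ n.toAdd := rfl

theorem lampHom_injective : Function.Injective lampHom := by
  rw [injective_iff_map_eq_one]
  rintro ⟨l, n⟩ h
  rw [lampHom_mk] at h
  have key (f : PowerSeries (ZMod 3)) : lampSeries l.toAdd +
      (ratio ^ n.toAdd : (PowerSeries (ZMod 3))ˣ) * f = f := by
    apply seqEquiv.injective
    rw [← translation_seqEquiv, ← a_zpow_seqEquiv, ← Equiv.Perm.mul_apply, h, Equiv.Perm.one_apply]
  have hl : lampSeries l.toAdd = 0 := by simpa using key 0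
  have hn : Finsupp.single n.toAdd (1 : ZMod 3) = Finsupp.single 0 1 := by
    apply lampSeries_injective
    simpa [lampSeries_single, hl] using key geom
  have hl' : l.toAdd = 0 := lampSeries_injective (by rw [hl, map_zero])
  have hn' : n.toAdd = 0 := Finsupp.single_left_injective (one_ne_zero) hn
  exact SemidirectProduct.ext hl' hn'

theorem statePerm_mem_GA (s : ZMod 3) : statePerm nxtA outA s ∈ GA := by
  apply Subgroup.subset_closure
  revert s
  change ∀ s : Fin 3, _
  intro s
  fin_cases s
  · exact Or.inl rfl
  · exact Or.inr (Or.inl rfl)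
  · exact Or.inr (Or.inr rfl)

theorem translation_lampSeries_mem_GA (l : ℤ →₀ ZMod 3) :
    translation (.ofAdd (lampSeries l)) ∈ GA := by
  have ha : a ∈ GA := statePerm_mem_GA 0
  induction l using Finsupp.induction_linear with
  | zero => simp [one_mem]
  | add f g hf hg =>
    rw [map_add, ofAdd_add, map_mul]
    exact mul_mem hf hg
  | single i v =>
    have h := statePerm_mem_GA (-v)
    rw [statePerm_eq, neg_neg, Subgroup.mul_mem_cancel_right _ ha] at h
    rw [lampSeries_single, ← mul_smul_comm,
      ← Subgroup.mul_mem_cancel_right _ (zpow_mem ha i), ← a_zpow_mul_translation]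
    exact mul_mem (zpow_mem ha i) h

theorem range_lampHom : lampHom.range = GA := by
  apply le_antisymm
  · rintro _ ⟨⟨l, n⟩, rfl⟩
    rw [lampHom_mk]
    exact mul_mem (translation_lampSeries_mem_GA _) (zpow_mem (statePerm_mem_GA 0) _)
  · have h (s : ZMod 3) : statePerm nxtA outA s ∈ lampHom.range :=
      ⟨⟨.ofAdd (Finsupp.single 0 (-s)), .ofAdd 1⟩, by
        rw [lampHom_mk, statePerm_eq]; simp [lampSeries_single]⟩
    rw [GA, Subgroup.closure_le]
    rintro _ (rfl | rfl | rfl)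
    exacts [h 0, h 1, h 2]

/-- `G_A` is isomorphic to the lamplighter group `ℤ₃ ≀ ℤ`, i.e. to the
semidirect product `(⨁_{i ∈ ℤ} ℤ/3ℤ) ⋊ ℤ`, where `ℤ` acts on the direct sum
`ℤ →₀ ZMod 3` by shifting the coordinates (the generator `1` of `ℤ` acts as the
shift automorphism induced by `i ↦ i + 1`). -/
theorem GA_iso_lamplighter :
    Nonempty (GA ≃*
      (Multiplicative (ℤ →₀ ZMod 3) ⋊[zpowersHom (MulAut (Multiplicative (ℤ →₀ ZMod 3)))
        (AddEquiv.toMultiplicative (Finsupp.domCongr (Equiv.addRight (1 : ℤ))))]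
        Multiplicative ℤ)) := by
  exact ⟨((MonoidHom.ofInjective lampHom_injective).trans
    (MulEquiv.subgroupCongr range_lampHom)).symm⟩

end Lamplighter
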